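/- arXiv:2204.13454 — 3 statements merged into one kernel-verified Lean document; each statement's English description precedes it below -/
import Mathlib

section
/- Discrete parabolic setting: let V be a real inner product space with norm ‖·‖, let m : V × V → ℝ be a bounded symmetric bilinear form with m(v,v) ≥ 0 for all v ∈ V, let a : V × V → ℝ be a bounded bilinear form that is coercive with constant α > 0, i.e. a(v,v) ≥ α‖v‖² for all v ∈ V, let Δt > 0 and K ∈ ℕ, and let l be a continuous linear functional on V with dual norm ‖·‖_{V'} given by ‖R‖_{V'} = sup_{‖v‖≤1} |R(v)|. Let u : {0,1,…,K} → V satisfy the implicit Euler scheme m(u_k, v) + Δt·a(u_k, v) = m(u_{k−1}, v) + Δt·l(v) for all v ∈ V and all 1 ≤ k ≤ K. Let w : {0,1,…,K} → V be any sequence with w_0 = u_0, and define the residual functionals R_k(v) := l(v) − (1/Δt)·(m(w_k, v) − m(w_{k−1}, v)) − a(w_k, v) for 1 ≤ k ≤ K. Then (Σ_{k=1}^{K} Δt·‖u_k − w_k‖²)^{1/2} ≤ (1/α)·(Σ_{k=1}^{K} Δt·‖R_k‖_{V'}²)^{1/2}. -/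
/-- One step of the energy estimate for the implicit Euler error equation. -/
lemma implicitEuler_energy_step
    {V : Type*} [NormedAddCommGroup V] [NormedSpace ℝ V]
    (m a : V →ₗ[ℝ] V →ₗ[ℝ] ℝ)
    (hm_symm : ∀ u v : V, m u v = m v u) (hm_nonneg : ∀ v : V, 0 ≤ m v v)
    {α : ℝ} (hα : 0 < α) (ha_coer : ∀ v : V, α * ‖v‖ ^ 2 ≤ a v v)
    {Δt : ℝ} (hΔt : 0 ≤ Δt) (R : V →L[ℝ] ℝ) {e e' : V}
    (h : m e e + Δt * a e e = m e' e + Δt * R e) :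
    m e e + α * (Δt * ‖e‖ ^ 2) ≤ m e' e' + 1 / α * (Δt * ‖R‖ ^ 2) := by
  have hdiff : 0 ≤ m e e - 2 * m e' e + m e' e' := by
    have := hm_nonneg (e - e')
    simp only [map_sub, LinearMap.sub_apply, hm_symm e e'] at this
    linarith
  have hyoung : 2 * (‖R‖ * ‖e‖) ≤ α * ‖e‖ ^ 2 + 1 / α * ‖R‖ ^ 2 := by
    have hsq : α * ‖e‖ ^ 2 + 1 / α * ‖R‖ ^ 2 - 2 * (‖R‖ * ‖e‖)
        = 1 / α * (α * ‖e‖ - ‖R‖) ^ 2 := by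
      field_simp
      ring
    have : 0 ≤ 1 / α * (α * ‖e‖ - ‖R‖) ^ 2 := by positivity
    linarith
  have hR : R e ≤ ‖R‖ * ‖e‖ := (le_abs_self _).trans (R.le_opNorm e)
  have hstep : 0 ≤ Δt * (2 * a e e - 2 * R e - α * ‖e‖ ^ 2 + 1 / α * ‖R‖ ^ 2) :=
    mul_nonneg hΔt (by linarith [ha_coer e])
  linarith

open Finset in
/-- Residual-based a posteriori error estimate for the implicit Euler discretization of a
linear parabolic problem: the discrete L²(0,T;V) error of any approximate trajectory `w`
reproducing the initial value is bounded by `1/α` times the discrete L²-in-time norm of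
the dual norms of its residuals in the full-order time-stepping scheme. -/
theorem parabolic_residual_aposteriori_state_estimate
    {V : Type*} [NormedAddCommGroup V] [InnerProductSpace ℝ V]
    (m a : V →ₗ[ℝ] V →ₗ[ℝ] ℝ)
    (hm_bdd : ∃ Cm : ℝ, ∀ u v : V, |m u v| ≤ Cm * ‖u‖ * ‖v‖)
    (hm_symm : ∀ u v : V, m u v = m v u)
    (hm_nonneg : ∀ v : V, 0 ≤ m v v)
    (ha_bdd : ∃ Ca : ℝ, ∀ u v : V, |a u v| ≤ Ca * ‖u‖ * ‖v‖)
    (α : ℝ) (hα : 0 < α)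
    (ha_coer : ∀ v : V, α * ‖v‖ ^ 2 ≤ a v v)
    (Δt : ℝ) (hΔt : 0 < Δt) (K : ℕ)
    (l : V →L[ℝ] ℝ)
    (u : ℕ → V)
    (hu : ∀ k, 1 ≤ k → k ≤ K → ∀ v : V,
      m (u k) v + Δt * a (u k) v = m (u (k - 1)) v + Δt * l v)
    (w : ℕ → V) (hw0 : w 0 = u 0)
    (R : ℕ → V →L[ℝ] ℝ)
    (hR : ∀ k, 1 ≤ k → k ≤ K → ∀ v : V,
      R k v = l v - (1 / Δt) * (m (w k) v - m (w (k - 1)) v) - a (w k) v) :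
    Real.sqrt (∑ k ∈ Finset.Icc 1 K, Δt * ‖u k - w k‖ ^ 2) ≤
      (1 / α) * Real.sqrt (∑ k ∈ Finset.Icc 1 K, Δt * ‖R k‖ ^ 2) := by
  have energy : ∀ n ≤ K, m (u n - w n) (u n - w n)
      + α * ∑ k ∈ Finset.Icc 1 n, Δt * ‖u k - w k‖ ^ 2
      ≤ 1 / α * ∑ k ∈ Finset.Icc 1 n, Δt * ‖R k‖ ^ 2 := by
    intro n
    induction n with
    | zero => simp [hw0]
    | succ n ih =>
      intro hn
      have herr : m (u (n + 1) - w (n + 1)) (u (n + 1) - w (n + 1))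
          + Δt * a (u (n + 1) - w (n + 1)) (u (n + 1) - w (n + 1))
          = m (u n - w n) (u (n + 1) - w (n + 1))
            + Δt * R (n + 1) (u (n + 1) - w (n + 1)) := by
        generalize hv : u (n + 1) - w (n + 1) = v
        have hscheme := hu (n + 1) (by lia) hn v
        rw [hR (n + 1) (by lia) hn v, ← hv]
        simp only [Nat.add_sub_cancel, map_sub, LinearMap.sub_apply] at hscheme ⊢
        simp only [← hv, map_sub] at hscheme
        field_simp
        linarith
      have hstep := implicitEuler_energy_step m a hm_symm hm_nonneg hα ha_coer hΔt.le _ herr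
      rw [Finset.sum_Icc_succ_top (by lia), Finset.sum_Icc_succ_top (by lia)]
      linarith [ih (by lia)]
  have hbound : ∑ k ∈ Finset.Icc 1 K, Δt * ‖u k - w k‖ ^ 2
      ≤ (1 / α) ^ 2 * ∑ k ∈ Finset.Icc 1 K, Δt * ‖R k‖ ^ 2 := by
    rw [sq, mul_assoc, one_div_mul_eq_div α, le_div_iff₀' hα]
    linarith [energy K le_rfl, hm_nonneg (u K - w K)]
  calc Real.sqrt (∑ k ∈ Finset.Icc 1 K, Δt * ‖u k - w k‖ ^ 2)
      ≤ Real.sqrt ((1 / α) ^ 2 * ∑ k ∈ Finset.Icc 1 K, Δt * ‖R k‖ ^ 2) :=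
        Real.sqrt_le_sqrt hbound
    _ = 1 / α * Real.sqrt (∑ k ∈ Finset.Icc 1 K, Δt * ‖R k‖ ^ 2) := by
        rw [Real.sqrt_mul (by positivity), Real.sqrt_sq (by positivity)]
end

section
/- Discrete parabolic setting: let V be a real inner product space with norm ‖·‖, let m : V × V → ℝ be a bounded symmetric bilinear form with m(v,v) ≥ 0 for all v ∈ V, let a : V × V → ℝ be a bounded bilinear form that is coercive with constant α > 0, i.e. a(v,v) ≥ α‖v‖² for all v ∈ V, let Δt > 0 and K ∈ ℕ, and let l and s be continuous linear functionals on V with dual norm ‖·‖_{V'} given by ‖R‖_{V'} = sup_{‖v‖≤1} |R(v)|. Let u : {0,1,…,K} → V satisfy the implicit Euler scheme m(u_k, v) + Δt·a(u_k, v) = m(u_{k−1}, v) + Δt·l(v) for all v ∈ V and all 1 ≤ k ≤ K. Let w : {0,1,…,K} → V be any sequence with w_0 = u_0, and define the residual functionals R_k(v) := l(v) − (1/Δt)·(m(w_k, v) − m(w_{k−1}, v)) − a(w_k, v) for 1 ≤ k ≤ K. Then the output error satisfies (Σ_{k=1}^{K} Δt·|s(u_k) − s(w_k)|²)^{1/2}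 ≤ (‖s‖_{V'}/α)·(Σ_{k=1}^{K} Δt·‖R_k‖_{V'}²)^{1/2}. -/
/-- Summed energy estimate for an implicit Euler error equation with vanishing initial error. -/
theorem implicit_euler_energy_estimate
    {V : Type*} [NormedAddCommGroup V] [NormedSpace ℝ V]
    (m a : V →ₗ[ℝ] V →ₗ[ℝ] ℝ)
    (hm_symm : ∀ u v : V, m u v = m v u)
    (hm_nonneg : ∀ v : V, 0 ≤ m v v)
    {α : ℝ} (hα : 0 < α) (ha_coer : ∀ v : V, α * ‖v‖ ^ 2 ≤ a v v)
    {τ : ℝ} (hτ : 0 < τ) {K : ℕ} (R : ℕ → V →L[ℝ] ℝ) (e : ℕ → V) (he0 : e 0 = 0)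
    (he : ∀ k < K, m (e (k + 1)) (e (k + 1)) + τ * a (e (k + 1)) (e (k + 1)) =
      m (e k) (e (k + 1)) + τ * R (k + 1) (e (k + 1))) :
    ∀ n ≤ K, α ^ 2 * ∑ k ∈ Finset.Icc 1 n, τ * ‖e k‖ ^ 2 + α * m (e n) (e n) ≤
      ∑ k ∈ Finset.Icc 1 n, τ * ‖R k‖ ^ 2 := by
  intro n
  induction n with
  | zero => simp [he0]
  | succ n ih =>
    intro hn
    have ih := ih (by omega)
    rw [Finset.sum_Icc_succ_top (by omega), Finset.sum_Icc_succ_top (by omega)]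
    have hcross : 2 * m (e n) (e (n + 1)) ≤ m (e n) (e n) + m (e (n + 1)) (e (n + 1)) := by
      have h := hm_nonneg (e (n + 1) - e n)
      simp only [map_sub, LinearMap.sub_apply] at h
      linarith [hm_symm (e (n + 1)) (e n)]
    have hR : R (n + 1) (e (n + 1)) ≤ ‖R (n + 1)‖ * ‖e (n + 1)‖ :=
      (le_abs_self _).trans ((R (n + 1)).le_opNorm _)
    have hyoung : 2 * α * R (n + 1) (e (n + 1)) ≤
        ‖R (n + 1)‖ ^ 2 + α ^ 2 * ‖e (n + 1)‖ ^ 2 := by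
      nlinarith [mul_le_mul_of_nonneg_left hR hα.le, sq_nonneg (‖R (n + 1)‖ - α * ‖e (n + 1)‖)]
    have h₁ := mul_le_mul_of_nonneg_left hyoung hτ.le
    have h₂ := mul_le_mul_of_nonneg_left (ha_coer (e (n + 1))) (mul_pos hα hτ).le
    have h₃ := mul_le_mul_of_nonneg_left hcross hα.le
    have h₄ := congrArg (α * ·) (he n (by omega))
    linarith


open Finset in
/-- Residual-based a posteriori output error estimate for the implicit Euler discretization
of a linear parabolic problem with linear output functional `s`: the discrete L²(0,T) error
of the output of any approximate trajectory `w` reproducing the initial value is bounded by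
`‖s‖/α` times the discrete L²-in-time norm of the dual norms of its residuals. -/
theorem parabolic_residual_aposteriori_output_estimate
    {V : Type*} [NormedAddCommGroup V] [InnerProductSpace ℝ V]
    (m a : V →ₗ[ℝ] V →ₗ[ℝ] ℝ)
    (hm_bdd : ∃ Cm : ℝ, ∀ u v : V, |m u v| ≤ Cm * ‖u‖ * ‖v‖)
    (hm_symm : ∀ u v : V, m u v = m v u)
    (hm_nonneg : ∀ v : V, 0 ≤ m v v)
    (ha_bdd : ∃ Ca : ℝ, ∀ u v : V, |a u v| ≤ Ca * ‖u‖ * ‖v‖)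
    (α : ℝ) (hα : 0 < α)
    (ha_coer : ∀ v : V, α * ‖v‖ ^ 2 ≤ a v v)
    (Δt : ℝ) (hΔt : 0 < Δt) (K : ℕ)
    (l s : V →L[ℝ] ℝ)
    (u : ℕ → V)
    (hu : ∀ k, 1 ≤ k → k ≤ K → ∀ v : V,
      m (u k) v + Δt * a (u k) v = m (u (k - 1)) v + Δt * l v)
    (w : ℕ → V) (hw0 : w 0 = u 0)
    (R : ℕ → V →L[ℝ] ℝ)
    (hR : ∀ k, 1 ≤ k → k ≤ K → ∀ v : V,
      R k v = l v - (1 / Δt) * (m (w k) v - m (w (k - 1)) v) - a (w k) v) :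
    Real.sqrt (∑ k ∈ Finset.Icc 1 K, Δt * |s (u k) - s (w k)| ^ 2) ≤
      (‖s‖ / α) * Real.sqrt (∑ k ∈ Finset.Icc 1 K, Δt * ‖R k‖ ^ 2) := by
  have henergy := implicit_euler_energy_estimate m a hm_symm hm_nonneg hα ha_coer hΔt R
    (fun k => u k - w k) (by simp [hw0]) (K := K) (by
      intro k hk
      have h₁ := hu (k + 1) (by omega) hk (u (k + 1) - w (k + 1))
      have h₂ := hR (k + 1) (by omega) hk (u (k + 1) - w (k + 1))
      rw [Nat.add_sub_cancel] at h₁ h₂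
      rw [h₂, map_sub m, map_sub m, map_sub a]
      simp only [LinearMap.sub_apply]
      generalize u (k + 1) - w (k + 1) = v at *
      field_simp
      linarith) K le_rfl
  have hm := mul_nonneg hα.le (hm_nonneg (u K - w K))
  have hstate : ∑ k ∈ Finset.Icc 1 K, Δt * ‖u k - w k‖ ^ 2 ≤
      (∑ k ∈ Finset.Icc 1 K, Δt * ‖R k‖ ^ 2) / α ^ 2 := by
    rw [le_div_iff₀ (by positivity)]
    linarith
  refine Real.sqrt_le_iff.2 ⟨by positivity, ?_⟩
  rw [mul_pow, Real.sq_sqrt (Finset.sum_nonneg fun k _ => by positivity)]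
  calc ∑ k ∈ Finset.Icc 1 K, Δt * |s (u k) - s (w k)| ^ 2
      ≤ ∑ k ∈ Finset.Icc 1 K, ‖s‖ ^ 2 * (Δt * ‖u k - w k‖ ^ 2) := by
        refine Finset.sum_le_sum fun k _ => ?_
        have h : |s (u k) - s (w k)| ≤ ‖s‖ * ‖u k - w k‖ := by
          rw [← map_sub]
          exact s.le_opNorm _
        calc Δt * |s (u k) - s (w k)| ^ 2 ≤ Δt * (‖s‖ * ‖u k - w k‖) ^ 2 := by gcongr
          _ = _ := by ring
    _ = ‖s‖ ^ 2 * ∑ k ∈ Finset.Icc 1 K, Δt * ‖u k - w k‖ ^ 2 := by rw [Finset.mul_sum]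
    _ ≤ ‖s‖ ^ 2 * ((∑ k ∈ Finset.Icc 1 K, Δt * ‖R k‖ ^ 2) / α ^ 2) := by gcongr
    _ = _ := by ring
end

section
/- Let V be a real inner product space with norm ‖·‖, let m : V × V → ℝ be a bounded symmetric bilinear form with m(v,v) ≥ 0 for all v ∈ V, let a : V × V → ℝ be a bilinear form with a(v,v) ≥ α‖v‖² for all v ∈ V and some α > 0, and let Δt > 0. Suppose e', e ∈ V and a continuous linear functional R on V satisfy the error equation m(e, v) − m(e', v) + Δt·a(e, v) = Δt·R(v) for all v ∈ V. Then m(e, e) − m(e', e') + α·Δt·‖e‖² ≤ (Δt/α)·‖R‖_{V'}², where ‖R‖_{V'} = sup_{‖v‖≤1} |R(v)|. -/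
/-- One-step discrete energy inequality for the implicit Euler scheme: if the errors `e'`, `e`
at two consecutive time steps satisfy the error equation with residual functional `R`, then
`m(e,e) − m(e',e') + α·Δt·‖e‖² ≤ (Δt/α)·‖R‖²`. -/
theorem parabolic_one_step_energy_inequality
    {V : Type*} [NormedAddCommGroup V] [InnerProductSpace ℝ V]
    (m a : V →ₗ[ℝ] V →ₗ[ℝ] ℝ)
    (hm_bdd : ∃ Cm : ℝ, ∀ u v : V, |m u v| ≤ Cm * ‖u‖ * ‖v‖)
    (hm_symm : ∀ u v : V, m u v = m v u)
    (hm_nonneg : ∀ v : V, 0 ≤ m v v)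
    (α : ℝ) (hα : 0 < α)
    (ha_coer : ∀ v : V, α * ‖v‖ ^ 2 ≤ a v v)
    (Δt : ℝ) (hΔt : 0 < Δt)
    (e' e : V) (R : V →L[ℝ] ℝ)
    (herr : ∀ v : V, m e v - m e' v + Δt * a e v = Δt * R v) :
    m e e - m e' e' + α * Δt * ‖e‖ ^ 2 ≤ (Δt / α) * ‖R‖ ^ 2 := by
  have h_polar : 2 * m e' e ≤ m e e + m e' e' := by
    have h := hm_nonneg (e - e')
    simp only [map_sub, LinearMap.sub_apply] at h
    linarith [hm_symm e e']
  have h_dual : R e ≤ ‖R‖ * ‖e‖ := (le_abs_self _).trans (R.le_opNorm e)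
  have h_young : 2 * (‖R‖ * ‖e‖) - α * ‖e‖ ^ 2 ≤ ‖R‖ ^ 2 / α := by
    rw [le_div_iff₀ hα]
    nlinarith [sq_nonneg (‖R‖ - α * ‖e‖)]
  calc m e e - m e' e' + α * Δt * ‖e‖ ^ 2
      ≤ Δt * (2 * (R e - a e e) + α * ‖e‖ ^ 2) := by linarith [herr e]
    _ ≤ Δt * (‖R‖ ^ 2 / α) := by
        gcongr
        linarith [ha_coer e]
    _ = (Δt / α) * ‖R‖ ^ 2 := by ring
end
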